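/- Let X = (X,Σ,μ) and X' = (X',Σ',μ') be probability spaces and let Φ : L¹(X) → L¹(X') be a Markov embedding, i.e. a linear isometry which is a lattice homomorphism (|Φf| = Φ|f|) with Φ𝟙 = 𝟙. Let M(X) and M(X') denote the spaces of (equivalence classes modulo a.e. equality of) measurable ℂ-valued functions on X and X', respectively. Then there exists a unique map Φ̂ : M(X) → M(X') that extends Φ and is multiplicative (Φ̂(fg) = Φ̂f · Φ̂g for all f, g ∈ M(X)). Moreover Φ̂ has the following properties: it is a unital *-algebra homomorphism and a lattice homomorphism; ∫_{X'} Φ̂f dμ' = ∫_X f dμ for every 0 ≤ f ∈ M(X) (as an identity in [0,∞]); Φ̂ is an isometry for the metrics d_X(f,g) = ∫_X |f−g|/(1+|f−g|) dμ and d_{X'} defined analogously; and Φ̂ is bijective whenever Φ is bijective. -/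

import Mathlib

open MeasureTheory ComplexConjugate
open scoped ENNReal ComplexOrder

noncomputable section

section Aux

open Filter Topology

/-- Classes of measurable complex functions form a commutative ring. -/
@[reducible]
def MeasureTheory.AEEqFun.commRingComplex {α : Type*} [MeasurableSpace α] (μ : Measure α) :
    CommRing (α →ₘ[μ] ℂ) :=
  { (inferInstance : AddCommGroup (α →ₘ[μ] ℂ)), (inferInstance : CommMonoid (α →ₘ[μ] ℂ)) with
    left_distrib := fun f g h => AEEqFun.toGerm_injective (by
      simp only [AEEqFun.mul_toGerm, AEEqFun.add_toGerm, mul_add])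
    right_distrib := fun f g h => AEEqFun.toGerm_injective (by
      simp only [AEEqFun.mul_toGerm, AEEqFun.add_toGerm, add_mul])
    zero_mul := fun f => AEEqFun.toGerm_injective (by
      simp only [AEEqFun.mul_toGerm, AEEqFun.zero_toGerm, zero_mul])
    mul_zero := fun f => AEEqFun.toGerm_injective (by
      simp only [AEEqFun.mul_toGerm, AEEqFun.zero_toGerm, mul_zero]) }

attribute [local instance] MeasureTheory.AEEqFun.commRingComplex

variable {X : Type*} [MeasurableSpace X] {μ : Measure X}
  {X' : Type*} [MeasurableSpace X'] {μ' : Measure X'}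

/-- The class of `|f|`, as a complex-valued function. -/
def MeasureTheory.AEEqFun.complexAbs (f : X →ₘ[μ] ℂ) : X →ₘ[μ] ℂ :=
  f.comp (fun z => (‖z‖ : ℂ)) (by fun_prop)

theorem MeasureTheory.AEEqFun.coeFn_complexAbs (f : X →ₘ[μ] ℂ) :
    ⇑f.complexAbs =ᵐ[μ] fun x => (‖f x‖ : ℂ) :=
  AEEqFun.coeFn_comp _ _ f

/-- The class of `(1 + |f|)⁻¹`. -/
def MeasureTheory.AEEqFun.damping (f : X →ₘ[μ] ℂ) : X →ₘ[μ] ℂ :=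
  f.compMeasurable (fun z => (1 + (‖z‖ : ℂ))⁻¹) (by fun_prop)

theorem MeasureTheory.AEEqFun.coeFn_damping (f : X →ₘ[μ] ℂ) :
    ⇑f.damping =ᵐ[μ] fun x => (1 + (‖f x‖ : ℂ))⁻¹ :=
  AEEqFun.coeFn_compMeasurable _ _ f

theorem Complex.one_add_ofReal_norm_ne_zero (z : ℂ) : (1 + (‖z‖ : ℂ)) ≠ 0 := by
  have : (1 + ‖z‖ : ℝ) ≠ 0 := by positivity
  exact_mod_cast this

theorem Complex.norm_one_add_ofReal_norm (z : ℂ) : ‖1 + (‖z‖ : ℂ)‖ = 1 + ‖z‖ := by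
  rw [← Complex.ofReal_one, ← Complex.ofReal_add, Complex.norm_real]
  exact abs_of_nonneg (by positivity)

namespace MeasureTheory.AEEqFun

theorem coeFn_complex_one : ⇑(1 : X →ₘ[μ] ℂ) =ᵐ[μ] fun _ => (1 : ℂ) := AEEqFun.coeFn_one

theorem damping_mul_cancel (f : X →ₘ[μ] ℂ) : f.damping * (1 + f.complexAbs) = 1 := by
  refine AEEqFun.ext ?_
  filter_upwards [f.coeFn_damping, f.coeFn_complexAbs,
    AEEqFun.coeFn_mul f.damping (1 + f.complexAbs), AEEqFun.coeFn_add 1 f.complexAbs,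
    coeFn_complex_one (μ := μ)] with x h1 h2 h3 h4 h5
  rw [h3, Pi.mul_apply, h4, Pi.add_apply, h5, h1, h2,
    inv_mul_cancel₀ (Complex.one_add_ofReal_norm_ne_zero _)]

theorem norm_damping_le (f : X →ₘ[μ] ℂ) : ∀ᵐ x ∂μ, ‖f.damping x‖ ≤ 1 := by
  filter_upwards [f.coeFn_damping] with x h
  rw [h, norm_inv, Complex.norm_one_add_ofReal_norm]
  exact inv_le_one_of_one_le₀ (by linarith [norm_nonneg (f x)])

theorem norm_mul_damping_le (f : X →ₘ[μ] ℂ) : ∀ᵐ x ∂μ, ‖(f * f.damping) x‖ ≤ 1 := by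
  filter_upwards [f.coeFn_damping, AEEqFun.coeFn_mul f f.damping] with x h h2
  rw [h2, Pi.mul_apply, h, norm_mul, norm_inv, Complex.norm_one_add_ofReal_norm,
    ← div_eq_mul_inv, div_le_one (by positivity)]
  linarith

theorem norm_mul_le_one {f g : X →ₘ[μ] ℂ} (hf : ∀ᵐ x ∂μ, ‖f x‖ ≤ 1)
    (hg : ∀ᵐ x ∂μ, ‖g x‖ ≤ 1) : ∀ᵐ x ∂μ, ‖(f * g) x‖ ≤ 1 := by
  filter_upwards [hf, hg, AEEqFun.coeFn_mul f g] with x h1 h2 h3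
  rw [h3, Pi.mul_apply, norm_mul]
  exact mul_le_one₀ h1 (norm_nonneg _) h2

theorem complexAbs_mem_Lp (f : Lp ℂ 1 μ) : (f : X →ₘ[μ] ℂ).complexAbs ∈ Lp ℂ 1 μ := by
  refine Lp.mem_Lp_of_ae_le (g := f) ?_
  filter_upwards [(f : X →ₘ[μ] ℂ).coeFn_complexAbs] with x h
  rw [h]; simp

theorem complex_smul_eq_mul (c : ℂ) (f : X →ₘ[μ] ℂ) : c • f = (c • 1) * f := by
  refine AEEqFun.ext ?_
  filter_upwards [AEEqFun.coeFn_smul c f, AEEqFun.coeFn_smul c (1 : X →ₘ[μ] ℂ),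
    AEEqFun.coeFn_mul (c • 1) f, coeFn_complex_one (μ := μ)] with x h1 h2 h3 h4
  rw [h1, h3, Pi.mul_apply, h2, Pi.smul_apply, Pi.smul_apply, h4, smul_eq_mul, smul_eq_mul,
    mul_one]

end MeasureTheory.AEEqFun

/-- A Markov embedding between the `L¹` spaces of two measure spaces. -/
structure IsMarkovEmbedding (Φ : Lp ℂ 1 μ →ₗ[ℂ] Lp ℂ 1 μ') : Prop where
  norm_map : ∀ f : Lp ℂ 1 μ, ‖Φ f‖ = ‖f‖
  map_abs : ∀ f g : Lp ℂ 1 μ, (⇑g =ᵐ[μ] fun x => (‖f x‖ : ℂ)) →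
      ⇑(Φ g) =ᵐ[μ'] fun x => (‖Φ f x‖ : ℂ)
  map_one : ∀ e : Lp ℂ 1 μ, (⇑e =ᵐ[μ] fun _ => (1 : ℂ)) →
      ⇑(Φ e) =ᵐ[μ'] fun _ => (1 : ℂ)

namespace IsMarkovEmbedding

open AEEqFun

variable {Φ : Lp ℂ 1 μ →ₗ[ℂ] Lp ℂ 1 μ'}

theorem lintegral_map (hΦ : IsMarkovEmbedding Φ) (f : Lp ℂ 1 μ) :
    ∫⁻ x, ‖Φ f x‖ₑ ∂μ' = ∫⁻ x, ‖f x‖ₑ ∂μ := by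
  have h := hΦ.norm_map f
  rw [Lp.norm_def, Lp.norm_def, ENNReal.toReal_eq_toReal_iff' (Lp.eLpNorm_ne_top _)
    (Lp.eLpNorm_ne_top _), eLpNorm_one_eq_lintegral_enorm, eLpNorm_one_eq_lintegral_enorm] at h
  exact h

theorem continuous (hΦ : IsMarkovEmbedding Φ) : Continuous Φ :=
  (LinearIsometry.mk Φ hΦ.norm_map).continuous

theorem injective (hΦ : IsMarkovEmbedding Φ) : Function.Injective Φ :=
  (LinearIsometry.mk Φ hΦ.norm_map).injective

theorem map_one' (hΦ : IsMarkovEmbedding Φ) (e : Lp ℂ 1 μ) (he : (e : X →ₘ[μ] ℂ) = 1) :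
    (Φ e : X' →ₘ[μ'] ℂ) = 1 :=
  AEEqFun.ext ((hΦ.map_one e (by rw [he]; exact coeFn_complex_one)).trans
    coeFn_complex_one.symm)

/-- Disjoint functions are mapped to disjoint functions. -/
theorem map_mul_eq_zero (hΦ : IsMarkovEmbedding Φ) {u v : Lp ℂ 1 μ}
    (huv : (u : X →ₘ[μ] ℂ) * v = 0) : (Φ u : X' →ₘ[μ'] ℂ) * Φ v = 0 := by
  set nu : Lp ℂ 1 μ := ⟨_, complexAbs_mem_Lp u⟩ with hnu
  set nv : Lp ℂ 1 μ := ⟨_, complexAbs_mem_Lp v⟩ with hnv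
  have hu : ⇑nu =ᵐ[μ] fun x => (‖u x‖ : ℂ) := coeFn_complexAbs _
  have hv : ⇑nv =ᵐ[μ] fun x => (‖v x‖ : ℂ) := coeFn_complexAbs _
  have hs : ⇑(nu + nv) =ᵐ[μ] fun x => (‖(nu - nv) x‖ : ℂ) := by
    have h0 : ∀ᵐ x ∂μ, u x * v x = 0 := by
      have h := AEEqFun.coeFn_mul (u : X →ₘ[μ] ℂ) v
      rw [huv] at h
      filter_upwards [h, AEEqFun.coeFn_zero (μ := μ) (β := ℂ)] with x h1 h2
      rw [h2] at h1
      exact h1.symm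
    filter_upwards [h0, hu, hv, Lp.coeFn_add nu nv, Lp.coeFn_sub nu nv] with x h0 h1 h2 h3 h4
    rw [h3, h4, Pi.add_apply, Pi.sub_apply, h1, h2]
    rcases mul_eq_zero.1 h0 with h | h <;> simp [h]
  refine AEEqFun.ext ?_
  have hsum := hΦ.map_abs _ _ hs
  rw [map_add, map_sub] at hsum
  filter_upwards [hsum, hΦ.map_abs _ _ hu, hΦ.map_abs _ _ hv, Lp.coeFn_add (Φ nu) (Φ nv),
    Lp.coeFn_sub (Φ nu) (Φ nv), AEEqFun.coeFn_mul (Φ u : X' →ₘ[μ'] ℂ) (Φ v),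
    AEEqFun.coeFn_zero (μ := μ') (β := ℂ)] with x h1 h2 h3 h4 h5 h6 h7
  rw [h4, h5, Pi.add_apply, Pi.sub_apply, h2, h3, ← Complex.ofReal_add, ← Complex.ofReal_sub,
    Complex.norm_real, Real.norm_eq_abs, Complex.ofReal_inj] at h1
  rw [h6, h7, Pi.mul_apply, Pi.zero_apply, ← norm_eq_zero, norm_mul]
  have hsq := congrArg (· ^ 2) h1
  simp only [sq_abs] at hsq
  nlinarith

variable [IsProbabilityMeasure μ]

theorem map_mul_of_idempotent (hΦ : IsMarkovEmbedding Φ) {a e p : Lp ℂ 1 μ}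
    (he : (e : X →ₘ[μ] ℂ) * e = e) (hp : (p : X →ₘ[μ] ℂ) = a * e) :
    (Φ p : X' →ₘ[μ'] ℂ) = Φ a * Φ e := by
  have h1 : (1 : X →ₘ[μ] ℂ) ∈ Lp ℂ 1 μ := Lp.const_mem_Lp X μ (1 : ℂ)
  set i : Lp ℂ 1 μ := ⟨1, h1⟩ with hi
  have hi' := hΦ.map_one' i rfl
  have e1 := hΦ.map_mul_eq_zero (u := p) (v := i - e) (by
    rw [AddSubgroup.coe_sub, hp]
    linear_combination (-(a : X →ₘ[μ] ℂ)) * he)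
  have e2 := hΦ.map_mul_eq_zero (u := a - p) (v := e) (by
    rw [AddSubgroup.coe_sub, hp]
    linear_combination (-(a : X →ₘ[μ] ℂ)) * he)
  rw [map_sub, AddSubgroup.coe_sub] at e1 e2
  rw [hi'] at e1
  linear_combination e1 - e2

theorem map_norm_le (hΦ : IsMarkovEmbedding Φ) {b : Lp ℂ 1 μ} {C : ℝ}
    (hb : ∀ᵐ x ∂μ, ‖b x‖ ≤ C) : ∀ᵐ x ∂μ', ‖Φ b x‖ ≤ C := by
  have h1 : (1 : X →ₘ[μ] ℂ) ∈ Lp ℂ 1 μ := Lp.const_mem_Lp X μ (1 : ℂ)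
  set i : Lp ℂ 1 μ := ⟨1, h1⟩ with hi
  have hi1 : ⇑i =ᵐ[μ] fun _ => (1 : ℂ) := coeFn_complex_one
  set nb : Lp ℂ 1 μ := ⟨_, complexAbs_mem_Lp b⟩ with hnb
  have hnb' : ⇑nb =ᵐ[μ] fun x => (‖b x‖ : ℂ) := coeFn_complexAbs _
  have hs : ⇑((C : ℂ) • i - nb) =ᵐ[μ] fun x => (‖((C : ℂ) • i - nb) x‖ : ℂ) := by
    filter_upwards [hb, hi1, hnb', Lp.coeFn_sub ((C : ℂ) • i) nb, Lp.coeFn_smul (C : ℂ) i]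
      with x h1 h2 h3 h4 h5
    rw [h4, Pi.sub_apply, h5, Pi.smul_apply, h2, h3, smul_eq_mul, mul_one, ← Complex.ofReal_sub,
      Complex.norm_real, Real.norm_eq_abs, abs_of_nonneg (by linarith)]
  have hm := hΦ.map_abs _ _ hs
  rw [map_sub, map_smul] at hm
  filter_upwards [hm, hΦ.map_one i hi1, hΦ.map_abs _ _ hnb',
    Lp.coeFn_sub ((C : ℂ) • Φ i) (Φ nb), Lp.coeFn_smul (C : ℂ) (Φ i)] with x h1 h2 h3 h4 h5
  rw [h4, Pi.sub_apply, h5, Pi.smul_apply, h2, h3, smul_eq_mul, mul_one, ← Complex.ofReal_sub,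
    Complex.norm_real, Complex.ofReal_inj] at h1
  linarith [norm_nonneg (C - ‖Φ b x‖)]

variable [IsProbabilityMeasure μ']

theorem map_mul_of_bounded (hΦ : IsMarkovEmbedding Φ) {a b p : Lp ℂ 1 μ} {C : ℝ}
    (hb : ∀ᵐ x ∂μ, ‖b x‖ ≤ C) (hp : (p : X →ₘ[μ] ℂ) = a * b) :
    (Φ p : X' →ₘ[μ'] ℂ) = Φ a * Φ b := by
  set B : Lp ℂ ∞ μ := ⟨b, Lp.mem_Lp_of_ae_bound C hb⟩ with hB
  set B' : Lp ℂ ∞ μ' := ⟨Φ b, Lp.mem_Lp_of_ae_bound C (hΦ.map_norm_le hb)⟩ with hB'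
  set L := (ContinuousLinearMap.mul ℂ ℂ).holderL μ ∞ 1 1 B with hL
  set L' := (ContinuousLinearMap.mul ℂ ℂ).holderL μ' ∞ 1 1 B' with hL'
  have L_apply : ∀ f : Lp ℂ 1 μ, (L f : X →ₘ[μ] ℂ) = b * f := fun f => AEEqFun.ext
    (((ContinuousLinearMap.mul ℂ ℂ).coeFn_holder B f).trans (AEEqFun.coeFn_mul _ _).symm)
  have L'_apply : ∀ f : Lp ℂ 1 μ', (L' f : X' →ₘ[μ'] ℂ) = Φ b * f := fun f => AEEqFun.ext
    (((ContinuousLinearMap.mul ℂ ℂ).coeFn_holder B' f).trans (AEEqFun.coeFn_mul _ _).symm)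
  have key : ∀ f : Lp ℂ 1 μ, Φ (L f) = L' (Φ f) := by
    intro f
    induction f using Lp.induction ENNReal.one_ne_top with
    | indicatorConst c hs hμs =>
      rename_i s
      set e : Lp ℂ 1 μ := indicatorConstLp 1 hs hμs.ne (1 : ℂ) with he
      have hce : (Lp.simpleFunc.indicatorConst 1 hs hμs.ne c : Lp ℂ 1 μ) = c • e := by
        rw [Lp.simpleFunc.coe_indicatorConst, he]
        refine Lp.ext ?_
        filter_upwards [indicatorConstLp_coeFn (p := 1) (hs := hs) (hμs := hμs.ne) (c := c),
          indicatorConstLp_coeFn (p := 1) (hs := hs) (hμs := hμs.ne) (c := (1 : ℂ)),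
          Lp.coeFn_smul c (indicatorConstLp 1 hs hμs.ne (1 : ℂ))] with x h1 h2 h3
        rw [h1, h3, Pi.smul_apply, h2]
        by_cases hx : x ∈ s <;> simp [hx]
      rw [hce]
      simp only [map_smul]
      congr 1
      refine Subtype.ext ?_
      rw [L'_apply]
      refine hΦ.map_mul_of_idempotent (AEEqFun.ext ?_) (L_apply e)
      filter_upwards [indicatorConstLp_coeFn (p := 1) (hs := hs) (hμs := hμs.ne) (c := (1 : ℂ)),
        AEEqFun.coeFn_mul (e : X →ₘ[μ] ℂ) e] with x h1 h2
      rw [h2, Pi.mul_apply, h1]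
      by_cases hx : x ∈ s <;> simp [hx]
    | add hf hg _ h1 h2 => simp only [map_add, h1, h2]
    | isClosed =>
      exact isClosed_eq (hΦ.continuous.comp L.continuous) (L'.continuous.comp hΦ.continuous)
  have hpL : p = L a := Subtype.ext (by rw [L_apply, hp, mul_comm])
  rw [hpL, key, L'_apply, mul_comm]

/-- The image of an almost everywhere nonvanishing function is almost everywhere nonvanishing. -/
theorem map_ae_ne_zero (hΦ : IsMarkovEmbedding Φ) {a : Lp ℂ 1 μ} (ha : ∀ᵐ x ∂μ, a x ≠ 0) :
    ∀ᵐ x ∂μ', Φ a x ≠ 0 := by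
  have h1 : (1 : X →ₘ[μ] ℂ) ∈ Lp ℂ 1 μ := Lp.const_mem_Lp X μ (1 : ℂ)
  set i : Lp ℂ 1 μ := ⟨1, h1⟩ with hi
  have hi1 : ⇑i =ᵐ[μ] fun _ => (1 : ℂ) := coeFn_complex_one
  have hden : ∀ (n : ℕ) (z : ℂ), (1 + (n : ℂ) * (‖z‖ : ℂ) ^ 2) ≠ 0 := by
    intro n z
    have : (1 + (n : ℝ) * ‖z‖ ^ 2) ≠ 0 := by positivity
    exact_mod_cast this
  have hnden : ∀ (n : ℕ) (z : ℂ), ‖1 + (n : ℂ) * (‖z‖ : ℂ) ^ 2‖ = 1 + n * ‖z‖ ^ 2 := by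
    intro n z
    have : (1 + (n : ℂ) * (‖z‖ : ℂ) ^ 2) = ((1 + n * ‖z‖ ^ 2 : ℝ) : ℂ) := by push_cast; rfl
    rw [this, Complex.norm_real]
    exact abs_of_nonneg (by positivity)
  set v : ℕ → X →ₘ[μ] ℂ := fun n => (a : X →ₘ[μ] ℂ).compMeasurable
    (fun z => (n : ℂ) * conj z / (1 + (n : ℂ) * (‖z‖ : ℂ) ^ 2))
    (by have : Measurable (fun z : ℂ => conj z) := Complex.continuous_conj.measurable
        fun_prop) with hv
  have hv1 : ∀ n, ⇑(v n) =ᵐ[μ]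
      fun x => (n : ℂ) * conj (a x) / (1 + (n : ℂ) * (‖a x‖ : ℂ) ^ 2) :=
    fun n => coeFn_compMeasurable _ _ _
  have hvb : ∀ n, ∀ᵐ x ∂μ, ‖v n x‖ ≤ (n : ℝ) := by
    intro n
    filter_upwards [hv1 n] with x hx
    rw [hx, norm_div, hnden, norm_mul, RCLike.norm_conj, Complex.norm_natCast,
      div_le_iff₀ (by positivity)]
    rcases Nat.eq_zero_or_pos n with rfl | hn
    · simp
    · have hn' : (1 : ℝ) ≤ n := by exact_mod_cast hn
      refine mul_le_mul_of_nonneg_left ?_ (by positivity)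
      nlinarith [sq_nonneg (‖a x‖ - 1), sq_nonneg ‖a x‖]
  set V : ℕ → Lp ℂ 1 μ := fun n => ⟨v n, Lp.mem_Lp_of_ae_bound _ (hvb n)⟩ with hV
  have hub : ∀ n, ∀ᵐ x ∂μ, ‖((a : X →ₘ[μ] ℂ) * v n) x‖ ≤ 1 := by
    intro n
    filter_upwards [hv1 n, AEEqFun.coeFn_mul (a : X →ₘ[μ] ℂ) (v n)] with x hx hx2
    rw [hx2, Pi.mul_apply, hx, norm_mul, norm_div, hnden, norm_mul, RCLike.norm_conj,
      Complex.norm_natCast, ← mul_div_assoc, div_le_one (by positivity)]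
    nlinarith
  set U : ℕ → Lp ℂ 1 μ := fun n => ⟨a * v n, Lp.mem_Lp_of_ae_bound _ (hub n)⟩ with hU
  have hΦU : ∀ n, (Φ (U n) : X' →ₘ[μ'] ℂ) = Φ a * Φ (V n) := fun n =>
    hΦ.map_mul_of_bounded (b := V n) (hvb n) rfl
  have hW : ∀ n, ⇑(i - U n) =ᵐ[μ] fun x => (1 + (n : ℂ) * (‖a x‖ : ℂ) ^ 2)⁻¹ := by
    intro n
    filter_upwards [hv1 n, AEEqFun.coeFn_mul (a : X →ₘ[μ] ℂ) (v n), Lp.coeFn_sub i (U n), hi1]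
      with x h1 h2 h3 h4
    have h5 : U n x = a x * v n x := h2
    rw [h3, Pi.sub_apply, h4, h5, h1]
    have h6 : a x * conj (a x) = (‖a x‖ : ℂ) ^ 2 := Complex.mul_conj' _
    have := hden n (a x)
    field_simp
    linear_combination (-(n : ℂ)) * h6
  have hlim : Tendsto (fun n => ∫⁻ x, ‖(i - U n) x‖ₑ ∂μ) atTop (𝓝 (∫⁻ _, 0 ∂μ)) := by
    refine tendsto_lintegral_of_dominated_convergence (fun _ => 1)
      (fun n => (Lp.stronglyMeasurable _).enorm) (fun n => ?_) (by simp) ?_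
    · filter_upwards [hW n] with x hx
      rw [hx, ← ofReal_norm, norm_inv, hnden]
      refine ENNReal.ofReal_le_one.2 (inv_le_one_of_one_le₀ ?_)
      have : 0 ≤ (n : ℝ) * ‖a x‖ ^ 2 := by positivity
      linarith
    · filter_upwards [ae_all_iff.2 hW, ha] with x hx hax
      have hpos : 0 < ‖a x‖ ^ 2 := by positivity
      have ht : Tendsto (fun n : ℕ => (1 + (n : ℝ) * ‖a x‖ ^ 2)⁻¹) atTop (𝓝 0) :=
        (tendsto_atTop_add_const_left _ _
          (tendsto_natCast_atTop_atTop.atTop_mul_const hpos)).inv_tendsto_atTop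
      have ht2 := ENNReal.tendsto_ofReal ht
      rw [ENNReal.ofReal_zero] at ht2
      refine ht2.congr fun n => ?_
      rw [hx n, ← ofReal_norm, norm_inv, hnden]
  rw [lintegral_zero] at hlim
  have hE : ∀ n, μ' {x | ¬ (Φ a x ≠ 0)} ≤ ∫⁻ x, ‖(i - U n) x‖ₑ ∂μ := by
    intro n
    rw [← hΦ.lintegral_map]
    calc μ' {x | ¬ (Φ a x ≠ 0)} ≤ μ' {x | 1 ≤ ‖Φ (i - U n) x‖ₑ} := by
          refine measure_mono_ae ?_
          have h := AEEqFun.coeFn_mul (Φ a : X' →ₘ[μ'] ℂ) (Φ (V n))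
          rw [← hΦU] at h
          rw [map_sub]
          filter_upwards [h, Lp.coeFn_sub (Φ i) (Φ (U n)), hΦ.map_one i hi1] with x h2 h3 h4 hx
          have hx0 : Φ a x = 0 := not_not.1 hx
          change 1 ≤ ‖(Φ i - Φ (U n)) x‖ₑ
          rw [h3, Pi.sub_apply, h4, h2, Pi.mul_apply, hx0, zero_mul, sub_zero]
          simp
      _ ≤ ∫⁻ x, ‖Φ (i - U n) x‖ₑ ∂μ' := by
          simpa using mul_meas_ge_le_lintegral (μ := μ')
            (Lp.stronglyMeasurable (Φ (i - U n))).enorm 1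
  exact le_antisymm (ge_of_tendsto' hlim hE) zero_le

theorem isUnit_map (hΦ : IsMarkovEmbedding Φ) {a : Lp ℂ 1 μ} (ha : ∀ᵐ x ∂μ, a x ≠ 0) :
    IsUnit (Φ a : X' →ₘ[μ'] ℂ) := by
  refine IsUnit.of_mul_eq_one
    ((Φ a : X' →ₘ[μ'] ℂ).compMeasurable (fun z => z⁻¹) measurable_inv) (AEEqFun.ext ?_)
  set k := (Φ a : X' →ₘ[μ'] ℂ).compMeasurable (fun z => z⁻¹) measurable_inv with hk
  filter_upwards [coeFn_compMeasurable (fun z : ℂ => z⁻¹) measurable_inv (Φ a : X' →ₘ[μ'] ℂ),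
    AEEqFun.coeFn_mul (Φ a : X' →ₘ[μ'] ℂ) k, coeFn_complex_one (μ := μ'),
    hΦ.map_ae_ne_zero ha] with x h1 h2 h3 h4
  rw [h2, h3, Pi.mul_apply, h1]
  exact mul_inv_cancel₀ h4

end IsMarkovEmbedding

/-- A multiplicative extension of `Φ` to all measurable functions. -/
structure IsMultiplicativeExtension (Φ : Lp ℂ 1 μ →ₗ[ℂ] Lp ℂ 1 μ')
    (Φhat : (X →ₘ[μ] ℂ) → (X' →ₘ[μ'] ℂ)) : Prop where
  extends_map : ∀ f : Lp ℂ 1 μ, Φhat ↑f = ↑(Φ f)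
  map_mul : ∀ f g : X →ₘ[μ] ℂ, Φhat (f * g) = Φhat f * Φhat g

open AEEqFun in
theorem IsMarkovEmbedding.exists_isMultiplicativeExtension {Φ : Lp ℂ 1 μ →ₗ[ℂ] Lp ℂ 1 μ'}
    [IsProbabilityMeasure μ] [IsProbabilityMeasure μ'] (hΦ : IsMarkovEmbedding Φ) :
    ∃ Φhat, IsMultiplicativeExtension Φ Φhat := by
  let T : ∀ f : X →ₘ[μ] ℂ, (∀ᵐ x ∂μ, ‖f x‖ ≤ 1) → (X' →ₘ[μ'] ℂ) :=
    fun f hf => Φ ⟨f, Lp.mem_Lp_of_ae_bound 1 hf⟩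
  have T_congr : ∀ {f g : X →ₘ[μ] ℂ} (hf hg), f = g → T f hf = T g hg := by
    rintro f g hf hg rfl; rfl
  have T_mul : ∀ {f g : X →ₘ[μ] ℂ} (hf hg), T (f * g) (norm_mul_le_one hf hg) = T f hf * T g hg :=
    fun hf hg => hΦ.map_mul_of_bounded (b := ⟨_, Lp.mem_Lp_of_ae_bound 1 hg⟩) hg rfl
  have hu : ∀ f : X →ₘ[μ] ℂ, IsUnit (T f.damping f.norm_damping_le) := by
    intro f
    refine hΦ.isUnit_map ?_
    filter_upwards [f.coeFn_damping] with x hx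
    change f.damping x ≠ 0
    rw [hx]
    exact inv_ne_zero (Complex.one_add_ofReal_norm_ne_zero _)
  have hex : ∀ f : X →ₘ[μ] ℂ, ∃ h : X' →ₘ[μ'] ℂ,
      h * T f.damping f.norm_damping_le = T (f * f.damping) f.norm_mul_damping_le := by
    intro f
    obtain ⟨k, hk⟩ := (hu f).exists_left_inv
    exact ⟨T (f * f.damping) f.norm_mul_damping_le * k, by rw [mul_assoc, hk, mul_one]⟩
  choose Φhat hΦhat using hex
  refine ⟨Φhat, fun f => ?_, fun f g => ?_⟩
  · refine (hu f).mul_right_cancel ?_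
    rw [hΦhat]
    exact hΦ.map_mul_of_bounded (b := ⟨_, Lp.mem_Lp_of_ae_bound 1 (norm_damping_le _)⟩)
      (norm_damping_le _) rfl
  · refine (((hu (f * g)).mul (hu f)).mul (hu g)).mul_right_cancel ?_
    have hf := hΦhat f
    have hg := hΦhat g
    have hfg := hΦhat (f * g)
    have b1 := norm_mul_le_one (f * g).norm_mul_damping_le f.norm_damping_le
    have b2 := norm_mul_le_one f.norm_mul_damping_le g.norm_mul_damping_le
    have h1 := T_mul b1 g.norm_damping_le
    rw [T_mul (f * g).norm_mul_damping_le f.norm_damping_le] at h1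
    have h2 := T_mul b2 (f * g).norm_damping_le
    rw [T_mul f.norm_mul_damping_le g.norm_mul_damping_le] at h2
    have h3 := (h1.symm.trans (T_congr (norm_mul_le_one b1 g.norm_damping_le)
      (norm_mul_le_one b2 (f * g).norm_damping_le) (by ring))).trans h2
    rw [← hf, ← hg, ← hfg] at h3
    linear_combination h3

/-- The class of `c |f| / (c + |f|)`. -/
def MeasureTheory.AEEqFun.softMin (c : ℝ) (f : X →ₘ[μ] ℂ) : X →ₘ[μ] ℂ :=
  f.compMeasurable (fun z => ((c * ‖z‖ / (c + ‖z‖) : ℝ) : ℂ)) (by fun_prop)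

theorem MeasureTheory.AEEqFun.coeFn_softMin (c : ℝ) (f : X →ₘ[μ] ℂ) :
    ⇑(f.softMin c) =ᵐ[μ] fun x => ((c * ‖f x‖ / (c + ‖f x‖) : ℝ) : ℂ) :=
  AEEqFun.coeFn_compMeasurable _ _ f

theorem MeasureTheory.AEEqFun.norm_softMin_le {c : ℝ} (hc : 0 < c) (f : X →ₘ[μ] ℂ) :
    ∀ᵐ x ∂μ, ‖f.softMin c x‖ ≤ c := by
  filter_upwards [f.coeFn_softMin c] with x hx
  rw [hx, Complex.norm_real, Real.norm_eq_abs, abs_of_nonneg (by positivity),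
    div_le_iff₀ (by positivity)]
  nlinarith

theorem tendsto_lintegral_softMin (f : X →ₘ[μ] ℂ) :
    Tendsto (fun n : ℕ => ∫⁻ x, ENNReal.ofReal
      (((n : ℝ) + 1) * ‖f x‖ / (((n : ℝ) + 1) + ‖f x‖)) ∂μ) atTop (𝓝 (∫⁻ x, ‖f x‖ₑ ∂μ)) := by
  refine lintegral_tendsto_of_tendsto_of_monotone (fun n => ?_) (.of_forall fun x n m hnm => ?_)
    (.of_forall fun x => ?_)
  · have := f.measurable
    fun_prop
  · refine ENNReal.ofReal_le_ofReal ?_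
    have hnm' : (n : ℝ) ≤ m := by exact_mod_cast hnm
    rw [div_le_div_iff₀ (by positivity) (by positivity)]
    nlinarith [mul_nonneg (sub_nonneg.2 hnm') (mul_nonneg (norm_nonneg (f x)) (norm_nonneg (f x)))]
  · rw [← ofReal_norm]
    refine ENNReal.tendsto_ofReal ?_
    have h1 : Tendsto (fun n : ℕ => ((n : ℝ) + 1) + ‖f x‖) atTop atTop :=
      tendsto_atTop_add_const_right _ _
        (tendsto_atTop_add_const_right _ _ tendsto_natCast_atTop_atTop)
    have h2 : Tendsto (fun n : ℕ => ‖f x‖ - ‖f x‖ ^ 2 / (((n : ℝ) + 1) + ‖f x‖)) atTop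
        (𝓝 (‖f x‖ - 0)) := tendsto_const_nhds.sub (h1.const_div_atTop _)
    rw [sub_zero] at h2
    refine h2.congr fun n => ?_
    have : ((n : ℝ) + 1) + ‖f x‖ ≠ 0 := by positivity
    field_simp
    ring

namespace IsMultiplicativeExtension

open AEEqFun

variable {Φ : Lp ℂ 1 μ →ₗ[ℂ] Lp ℂ 1 μ'} {Φhat : (X →ₘ[μ] ℂ) → (X' →ₘ[μ'] ℂ)}
  [IsProbabilityMeasure μ]

theorem map_one (hE : IsMultiplicativeExtension Φ Φhat) (hΦ : IsMarkovEmbedding Φ) :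
    Φhat 1 = 1 := by
  have h1 : (1 : X →ₘ[μ] ℂ) ∈ Lp ℂ 1 μ := Lp.const_mem_Lp X μ (1 : ℂ)
  rw [← hΦ.map_one' ⟨1, h1⟩ rfl]
  exact hE.extends_map ⟨1, h1⟩

theorem isUnit_map_damping (hE : IsMultiplicativeExtension Φ Φhat) (hΦ : IsMarkovEmbedding Φ)
    (f : X →ₘ[μ] ℂ) : IsUnit (Φhat f.damping) := by
  refine IsUnit.of_mul_eq_one (Φhat (1 + f.complexAbs)) ?_
  rw [← hE.map_mul, damping_mul_cancel, hE.map_one hΦ]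

theorem map_eq_of_norm_le (hE : IsMultiplicativeExtension Φ Φhat) {f : X →ₘ[μ] ℂ} {C : ℝ}
    (hf : ∀ᵐ x ∂μ, ‖f x‖ ≤ C) : Φhat f = Φ ⟨f, Lp.mem_Lp_of_ae_bound C hf⟩ :=
  hE.extends_map ⟨f, Lp.mem_Lp_of_ae_bound C hf⟩

theorem unique (hE : IsMultiplicativeExtension Φ Φhat) (hΦ : IsMarkovEmbedding Φ)
    {Ψ : (X →ₘ[μ] ℂ) → (X' →ₘ[μ'] ℂ)} (hΨ : IsMultiplicativeExtension Φ Ψ) : Ψ = Φhat := by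
  funext f
  refine (hE.isUnit_map_damping hΦ f).mul_right_cancel ?_
  rw [← hE.map_mul, hE.map_eq_of_norm_le f.norm_mul_damping_le,
    hE.map_eq_of_norm_le f.norm_damping_le, ← hΨ.map_eq_of_norm_le f.norm_mul_damping_le,
    ← hΨ.map_eq_of_norm_le f.norm_damping_le, hΨ.map_mul]

theorem map_add (hE : IsMultiplicativeExtension Φ Φhat) (hΦ : IsMarkovEmbedding Φ)
    (f g : X →ₘ[μ] ℂ) : Φhat (f + g) = Φhat f + Φhat g := by
  refine ((hE.isUnit_map_damping hΦ f).mul (hE.isUnit_map_damping hΦ g)).mul_right_cancel ?_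
  have hf := norm_mul_le_one f.norm_mul_damping_le g.norm_damping_le
  have hg := norm_mul_le_one g.norm_mul_damping_le f.norm_damping_le
  set F : Lp ℂ 1 μ := ⟨_, Lp.mem_Lp_of_ae_bound 1 hf⟩ with hF
  set G : Lp ℂ 1 μ := ⟨_, Lp.mem_Lp_of_ae_bound 1 hg⟩ with hG
  have h := hE.extends_map (F + G)
  rw [_root_.map_add, AddSubgroup.coe_add, AddSubgroup.coe_add, ← hE.extends_map,
    ← hE.extends_map] at h
  simp only [hF, hG] at h
  have e : (f + g) * (f.damping * g.damping) =
      f * f.damping * g.damping + g * g.damping * f.damping := by ring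
  rw [← hE.map_mul f.damping, ← hE.map_mul, e, h, hE.map_mul, hE.map_mul, hE.map_mul, hE.map_mul,
    hE.map_mul]
  ring

theorem map_smul (hE : IsMultiplicativeExtension Φ Φhat) (hΦ : IsMarkovEmbedding Φ)
    (c : ℂ) (f : X →ₘ[μ] ℂ) : Φhat (c • f) = c • Φhat f := by
  have h1 : (1 : X →ₘ[μ] ℂ) ∈ Lp ℂ 1 μ := Lp.const_mem_Lp X μ (1 : ℂ)
  have h : Φhat (c • (1 : X →ₘ[μ] ℂ)) = c • (Φ ⟨1, h1⟩ : X' →ₘ[μ'] ℂ) := by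
    refine (hE.extends_map (c • ⟨1, h1⟩)).trans ?_
    rw [_root_.map_smul]
    rfl
  rw [hΦ.map_one' ⟨1, h1⟩ rfl] at h
  rw [AEEqFun.complex_smul_eq_mul, hE.map_mul, h, ← AEEqFun.complex_smul_eq_mul]

theorem map_sub (hE : IsMultiplicativeExtension Φ Φhat) (hΦ : IsMarkovEmbedding Φ)
    (f g : X →ₘ[μ] ℂ) : Φhat (f - g) = Φhat f - Φhat g := by
  rw [eq_sub_iff_add_eq, ← hE.map_add hΦ, sub_add_cancel]

theorem injective (hE : IsMultiplicativeExtension Φ Φhat) (hΦ : IsMarkovEmbedding Φ) :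
    Function.Injective Φhat := by
  intro f g hfg
  rw [← sub_eq_zero, ← hE.map_sub hΦ] at hfg
  rw [← sub_eq_zero]
  set k := f - g
  have h := hE.map_mul k k.damping
  rw [hfg, zero_mul, hE.map_eq_of_norm_le k.norm_mul_damping_le] at h
  have h0 : (⟨_, Lp.mem_Lp_of_ae_bound 1 k.norm_mul_damping_le⟩ : Lp ℂ 1 μ) = 0 :=
    hΦ.injective (by rw [_root_.map_zero]; exact Subtype.ext h)
  have h1 : k * k.damping = 0 := congrArg Subtype.val h0
  have h2 := k.damping_mul_cancel
  linear_combination (1 + k.complexAbs) * h1 - k * h2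

theorem map_complexAbs (hE : IsMultiplicativeExtension Φ Φhat) (hΦ : IsMarkovEmbedding Φ)
    (f : X →ₘ[μ] ℂ) : Φhat f.complexAbs = (Φhat f).complexAbs := by
  refine (hE.isUnit_map_damping hΦ f).mul_right_cancel ?_
  set D : Lp ℂ 1 μ := ⟨_, Lp.mem_Lp_of_ae_bound 1 f.norm_damping_le⟩ with hD
  set M : Lp ℂ 1 μ := ⟨_, Lp.mem_Lp_of_ae_bound 1 f.norm_mul_damping_le⟩ with hM
  have hDabs : ⇑D =ᵐ[μ] fun x => (‖D x‖ : ℂ) := by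
    filter_upwards [f.coeFn_damping] with x hx
    change f.damping x = (‖f.damping x‖ : ℂ)
    rw [hx, norm_inv, Complex.norm_one_add_ofReal_norm]
    push_cast
    rfl
  have hMabs : f.complexAbs * f.damping = (M : X →ₘ[μ] ℂ).complexAbs := by
    refine AEEqFun.ext ?_
    filter_upwards [hDabs, coeFn_complexAbs (M : X →ₘ[μ] ℂ), f.coeFn_complexAbs,
      AEEqFun.coeFn_mul f.complexAbs f.damping, AEEqFun.coeFn_mul f f.damping] with x h1 h2 h3 h4 h5
    have h1' : f.damping x = (‖f.damping x‖ : ℂ) := h1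
    rw [h4, h2, Pi.mul_apply, h3]
    change _ = (‖(f * f.damping) x‖ : ℂ)
    rw [h5, Pi.mul_apply, norm_mul, Complex.ofReal_mul, ← h1']
  rw [← hE.map_mul, hMabs]
  have e1 := hE.extends_map ⟨_, complexAbs_mem_Lp M⟩
  have e2 : Φhat f.damping = Φ D := hE.extends_map D
  have e3 : Φhat f * Φ D = Φ M := by rw [← e2, ← hE.map_mul]; exact hE.extends_map M
  rw [e2]
  refine e1.trans (AEEqFun.ext ?_)
  have h3 := AEEqFun.coeFn_mul (Φhat f) (Φ D)
  rw [e3] at h3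
  filter_upwards [hΦ.map_abs M ⟨_, complexAbs_mem_Lp M⟩ (coeFn_complexAbs _),
    hΦ.map_abs D D hDabs, h3, AEEqFun.coeFn_mul (Φhat f).complexAbs (Φ D),
    coeFn_complexAbs (Φhat f)] with x h1 h2 h3 h4 h5
  rw [h1, h3, h4, Pi.mul_apply, Pi.mul_apply, h5, norm_mul, Complex.ofReal_mul, ← h2]

theorem map_abs (hE : IsMultiplicativeExtension Φ Φhat) (hΦ : IsMarkovEmbedding Φ)
    {f g : X →ₘ[μ] ℂ} (hfg : ⇑g =ᵐ[μ] fun x => (‖f x‖ : ℂ)) :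
    ⇑(Φhat g) =ᵐ[μ'] fun x => (‖Φhat f x‖ : ℂ) := by
  have : g = f.complexAbs := AEEqFun.ext (hfg.trans f.coeFn_complexAbs.symm)
  rw [this, hE.map_complexAbs hΦ]
  exact coeFn_complexAbs _

theorem map_conj (hE : IsMultiplicativeExtension Φ Φhat) (hΦ : IsMarkovEmbedding Φ)
    {f g : X →ₘ[μ] ℂ} (hfg : ⇑g =ᵐ[μ] fun x => conj (f x)) :
    ⇑(Φhat g) =ᵐ[μ'] fun x => conj (Φhat f x) := by
  have h1 : g * f = f.complexAbs * f.complexAbs := by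
    refine AEEqFun.ext ?_
    filter_upwards [hfg, f.coeFn_complexAbs, AEEqFun.coeFn_mul g f,
      AEEqFun.coeFn_mul f.complexAbs f.complexAbs] with x h1 h2 h3 h4
    rw [h3, h4, Pi.mul_apply, Pi.mul_apply, h1, h2, Complex.conj_mul', sq]
  have h2 : ⇑f.complexAbs =ᵐ[μ] fun x => (‖g x‖ : ℂ) := by
    filter_upwards [hfg, f.coeFn_complexAbs] with x h1 h2
    rw [h1, h2, RCLike.norm_conj]
  have h3 := congrArg Φhat h1
  rw [hE.map_mul, hE.map_mul] at h3
  have h4 := AEEqFun.coeFn_mul (Φhat g) (Φhat f)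
  rw [h3] at h4
  filter_upwards [h4, AEEqFun.coeFn_mul (Φhat f.complexAbs) (Φhat f.complexAbs),
    hE.map_abs hΦ h2, hE.map_abs hΦ f.coeFn_complexAbs] with x h4 h5 h6 h7
  rw [h5, Pi.mul_apply, Pi.mul_apply, h7, ← sq, ← Complex.conj_mul'] at h4
  by_cases hx : Φhat f x = 0
  · rw [h7, hx] at h6
    have : Φhat g x = 0 := by simpa using h6.symm
    rw [this, hx, _root_.map_zero]
  · exact (mul_right_cancel₀ hx h4).symm

theorem lintegral_softMin (hE : IsMultiplicativeExtension Φ Φhat) (hΦ : IsMarkovEmbedding Φ)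
    {c : ℝ} (hc : 0 < c) (f : X →ₘ[μ] ℂ) :
    ∫⁻ x, ENNReal.ofReal (c * ‖Φhat f x‖ / (c + ‖Φhat f x‖)) ∂μ' =
      ∫⁻ x, ENNReal.ofReal (c * ‖f x‖ / (c + ‖f x‖)) ∂μ := by
  have hden : ∀ z : ℂ, (c : ℂ) + (‖z‖ : ℂ) ≠ 0 := by
    intro z
    have : c + ‖z‖ ≠ 0 := by positivity
    exact_mod_cast this
  have h1 : f.softMin c * ((c : ℂ) • 1 + f.complexAbs) = (c : ℂ) • f.complexAbs := by
    refine AEEqFun.ext ?_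
    filter_upwards [f.coeFn_softMin c, f.coeFn_complexAbs,
      AEEqFun.coeFn_mul (f.softMin c) ((c : ℂ) • 1 + f.complexAbs),
      AEEqFun.coeFn_add ((c : ℂ) • 1) f.complexAbs, AEEqFun.coeFn_smul (c : ℂ) (1 : X →ₘ[μ] ℂ),
      AEEqFun.coeFn_smul (c : ℂ) f.complexAbs, coeFn_complex_one (μ := μ)]
      with x h1 h2 h3 h4 h5 h6 h7
    rw [h3, h6, Pi.mul_apply, h4, Pi.add_apply, h5, Pi.smul_apply, Pi.smul_apply, h7, h1, h2,
      smul_eq_mul, smul_eq_mul, mul_one]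
    push_cast
    exact div_mul_cancel₀ _ (hden _)
  have h2 := congrArg Φhat h1
  rw [hE.map_mul, hE.map_add hΦ, hE.map_smul hΦ, hE.map_smul hΦ, hE.map_one hΦ,
    hE.map_complexAbs hΦ] at h2
  have h3 : ⇑(Φhat (f.softMin c)) =ᵐ[μ']
      fun x => ((c * ‖Φhat f x‖ / (c + ‖Φhat f x‖) : ℝ) : ℂ) := by
    have h3 := AEEqFun.coeFn_mul (Φhat (f.softMin c)) ((c : ℂ) • 1 + (Φhat f).complexAbs)
    rw [h2] at h3
    filter_upwards [h3, (Φhat f).coeFn_complexAbs,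
      AEEqFun.coeFn_add ((c : ℂ) • 1) (Φhat f).complexAbs,
      AEEqFun.coeFn_smul (c : ℂ) (1 : X' →ₘ[μ'] ℂ),
      AEEqFun.coeFn_smul (c : ℂ) (Φhat f).complexAbs, coeFn_complex_one (μ := μ')]
      with x h3 h2 h4 h5 h6 h7
    rw [h6, Pi.mul_apply, h4, Pi.add_apply, h5, Pi.smul_apply, Pi.smul_apply, h7, h2,
      smul_eq_mul, smul_eq_mul, mul_one] at h3
    push_cast
    exact eq_div_of_mul_eq (hden _) h3.symm
  rw [hE.map_eq_of_norm_le (f.norm_softMin_le hc)] at h3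
  have h4 := hΦ.lintegral_map ⟨_, Lp.mem_Lp_of_ae_bound c (f.norm_softMin_le hc)⟩
  have h5 : ∀ z : ℂ, ‖((c * ‖z‖ / (c + ‖z‖) : ℝ) : ℂ)‖ₑ =
      ENNReal.ofReal (c * ‖z‖ / (c + ‖z‖)) := by
    intro z
    rw [← ofReal_norm, Complex.norm_real, Real.norm_of_nonneg (by positivity)]
  refine Eq.trans ?_ (h4.trans ?_)
  · refine lintegral_congr_ae ?_
    filter_upwards [h3] with x hx
    rw [hx, h5]
  · refine lintegral_congr_ae ?_
    filter_upwards [f.coeFn_softMin c] with x hx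
    change ‖f.softMin c x‖ₑ = _
    rw [hx, h5]

theorem lintegral_enorm (hE : IsMultiplicativeExtension Φ Φhat) (hΦ : IsMarkovEmbedding Φ)
    (f : X →ₘ[μ] ℂ) : ∫⁻ x, ‖Φhat f x‖ₑ ∂μ' = ∫⁻ x, ‖f x‖ₑ ∂μ :=
  tendsto_nhds_unique (tendsto_lintegral_softMin (Φhat f))
    ((tendsto_lintegral_softMin f).congr fun n =>
      (hE.lintegral_softMin hΦ (by positivity) f).symm)

theorem lintegral_re (hE : IsMultiplicativeExtension Φ Φhat) (hΦ : IsMarkovEmbedding Φ)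
    {f : X →ₘ[μ] ℂ} (hf : ∀ᵐ x ∂μ, 0 ≤ f x) :
    ∫⁻ x, ENNReal.ofReal ((Φhat f x).re) ∂μ' = ∫⁻ x, ENNReal.ofReal ((f x).re) ∂μ := by
  have hfabs : ⇑f =ᵐ[μ] fun x => (‖f x‖ : ℂ) := by
    filter_upwards [hf] with x hx
    exact (Complex.eq_coe_norm_of_nonneg hx)
  have h := hE.lintegral_enorm hΦ f
  refine Eq.trans ?_ (h.trans ?_)
  · refine lintegral_congr_ae ?_
    filter_upwards [hE.map_abs hΦ hfabs] with x hx
    rw [← ofReal_norm]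
    congr 1
    simpa using congrArg Complex.re hx
  · refine lintegral_congr_ae ?_
    filter_upwards [hfabs] with x hx
    rw [← ofReal_norm]
    congr 1
    simpa using (congrArg Complex.re hx).symm

theorem integral_dist (hE : IsMultiplicativeExtension Φ Φhat) (hΦ : IsMarkovEmbedding Φ)
    (f g : X →ₘ[μ] ℂ) :
    ∫ x, ‖Φhat f x - Φhat g x‖ / (1 + ‖Φhat f x - Φhat g x‖) ∂μ' =
      ∫ x, ‖f x - g x‖ / (1 + ‖f x - g x‖) ∂μ := by
  have h := hE.lintegral_softMin hΦ one_pos (f - g)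
  rw [hE.map_sub hΦ] at h
  have hm := f.measurable
  have hm2 := g.measurable
  have hm3 := (Φhat f).measurable
  have hm4 := (Φhat g).measurable
  rw [integral_eq_lintegral_of_nonneg_ae (.of_forall fun x => by positivity)
      (Measurable.aestronglyMeasurable (by fun_prop)),
    integral_eq_lintegral_of_nonneg_ae (.of_forall fun x => by positivity)
      (Measurable.aestronglyMeasurable (by fun_prop))]
  congr 1
  refine Eq.trans ?_ (h.trans ?_)
  · refine lintegral_congr_ae ?_
    filter_upwards [AEEqFun.coeFn_sub (Φhat f) (Φhat g)] with x hx
    rw [hx, Pi.sub_apply, one_mul]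
  · refine lintegral_congr_ae ?_
    filter_upwards [AEEqFun.coeFn_sub f g] with x hx
    rw [hx, Pi.sub_apply, one_mul]

theorem surjective [IsProbabilityMeasure μ'] (hE : IsMultiplicativeExtension Φ Φhat)
    (hΦ : IsMarkovEmbedding Φ) (hsurj : Function.Surjective Φ) : Function.Surjective Φhat := by
  intro h
  obtain ⟨a, ha⟩ := hsurj ⟨_, Lp.mem_Lp_of_ae_bound 1 h.norm_damping_le⟩
  obtain ⟨b, hb⟩ := hsurj ⟨_, Lp.mem_Lp_of_ae_bound 1 h.norm_mul_damping_le⟩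
  have ha' : Φhat a = h.damping := by rw [hE.extends_map, ha]
  have hb' : Φhat b = h * h.damping := by rw [hE.extends_map, hb]
  have hu : IsUnit h.damping := IsUnit.of_mul_eq_one _ h.damping_mul_cancel
  have hmeas : Measurable (fun z : ℂ => z⁻¹) := measurable_inv
  set k := (a : X →ₘ[μ] ℂ).compMeasurable (fun z => z⁻¹) hmeas with hk
  have hk' : ⇑k =ᵐ[μ] fun x => (a x)⁻¹ := coeFn_compMeasurable _ _ _
  -- `a * k` is the indicator function of the set where `a` does not vanish.
  have hak : (a : X →ₘ[μ] ℂ) * (a * k) = a := by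
    refine AEEqFun.ext ?_
    filter_upwards [hk', AEEqFun.coeFn_mul (a : X →ₘ[μ] ℂ) k,
      AEEqFun.coeFn_mul (a : X →ₘ[μ] ℂ) (a * k)] with x h1 h2 h3
    rw [h3, Pi.mul_apply, h2, Pi.mul_apply, h1]
    by_cases hx : a x = 0
    · simp [hx]
    · rw [mul_inv_cancel₀ hx, mul_one]
  have hone : (a : X →ₘ[μ] ℂ) * k = 1 := by
    refine hE.injective hΦ (hu.mul_left_cancel ?_)
    rw [← ha', ← hE.map_mul, hak, hE.map_one hΦ, mul_one]
  refine ⟨b * k, hu.mul_right_cancel ?_⟩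
  rw [← hb', ← ha', ← hE.map_mul]
  congr 1
  linear_combination (b : X →ₘ[μ] ℂ) * hone

end IsMultiplicativeExtension

end Aux

/-- **Canonical extension of a Markov embedding to all measurable functions**
(Lemma `app.l:Phihut` of the paper).  A Markov embedding `Φ : L¹(X) → L¹(X')` between
probability spaces admits a unique multiplicative extension
`Φ̂ : M(X) → M(X')` to the spaces of a.e.-equivalence classes of measurable ℂ-valued
functions; `Φ̂` is a unital *-algebra and lattice homomorphism, preserves the integral
of nonnegative functions (as an identity in `[0,∞]`), is an isometry for the canonical
metrics `d(f,g) = ∫ |f−g|/(1+|f−g|)`, and is bijective whenever `Φ` is. -/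
theorem markov_embedding_extension
    {X : Type*} [MeasurableSpace X] {μ : Measure X} [IsProbabilityMeasure μ]
    {X' : Type*} [MeasurableSpace X'] {μ' : Measure X'} [IsProbabilityMeasure μ']
    (Φ : Lp ℂ 1 μ →ₗ[ℂ] Lp ℂ 1 μ')
    (hiso : ∀ f : Lp ℂ 1 μ, ‖Φ f‖ = ‖f‖)
    (hlat : ∀ f g : Lp ℂ 1 μ, (⇑g =ᵐ[μ] fun x => (‖f x‖ : ℂ)) →
      ⇑(Φ g) =ᵐ[μ'] fun x => (‖Φ f x‖ : ℂ))
    (hone : ∀ e : Lp ℂ 1 μ, (⇑e =ᵐ[μ] fun _ => (1 : ℂ)) →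
      ⇑(Φ e) =ᵐ[μ'] fun _ => (1 : ℂ)) :
    (∃! Φhat : (X →ₘ[μ] ℂ) → (X' →ₘ[μ'] ℂ),
      (∀ f : Lp ℂ 1 μ, Φhat ↑f = ↑(Φ f)) ∧
      (∀ f g : X →ₘ[μ] ℂ, Φhat (f * g) = Φhat f * Φhat g)) ∧
    ∀ Φhat : (X →ₘ[μ] ℂ) → (X' →ₘ[μ'] ℂ),
      (∀ f : Lp ℂ 1 μ, Φhat ↑f = ↑(Φ f)) →
      (∀ f g : X →ₘ[μ] ℂ, Φhat (f * g) = Φhat f * Φhat g) →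
      -- unital *-algebra homomorphism
      ((∀ f g : X →ₘ[μ] ℂ, Φhat (f + g) = Φhat f + Φhat g) ∧
       (∀ (c : ℂ) (f : X →ₘ[μ] ℂ), Φhat (c • f) = c • Φhat f) ∧
       (Φhat 1 = 1) ∧
       (∀ f g : X →ₘ[μ] ℂ, (⇑g =ᵐ[μ] fun x => conj (f x)) →
          ⇑(Φhat g) =ᵐ[μ'] fun x => conj (Φhat f x)) ∧
       -- lattice homomorphism
       (∀ f g : X →ₘ[μ] ℂ, (⇑g =ᵐ[μ] fun x => (‖f x‖ : ℂ)) →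
          ⇑(Φhat g) =ᵐ[μ'] fun x => (‖Φhat f x‖ : ℂ)) ∧
       -- integral preservation for nonnegative functions, in [0,∞]
       (∀ f : X →ₘ[μ] ℂ, (∀ᵐ x ∂μ, 0 ≤ f x) →
          ∫⁻ x, ENNReal.ofReal ((Φhat f x).re) ∂μ'
            = ∫⁻ x, ENNReal.ofReal ((f x).re) ∂μ) ∧
       -- isometry for the canonical metrics
       (∀ f g : X →ₘ[μ] ℂ,
          ∫ x, ‖Φhat f x - Φhat g x‖ / (1 + ‖Φhat f x - Φhat g x‖) ∂μ'
            = ∫ x, ‖f x - g x‖ / (1 + ‖f x - g x‖) ∂μ) ∧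
       -- bijectivity
       (Function.Bijective ⇑Φ → Function.Bijective Φhat)) := by
  have hΦ : IsMarkovEmbedding Φ := ⟨hiso, hlat, hone⟩
  constructor
  · obtain ⟨Φhat, hE⟩ := hΦ.exists_isMultiplicativeExtension
    exact ⟨Φhat, ⟨hE.extends_map, hE.map_mul⟩, fun Ψ hΨ => hE.unique hΦ ⟨hΨ.1, hΨ.2⟩⟩
  · intro Φhat hext hmul
    have hE : IsMultiplicativeExtension Φ Φhat := ⟨hext, hmul⟩
    exact ⟨hE.map_add hΦ, hE.map_smul hΦ, hE.map_one hΦ, fun _ _ => hE.map_conj hΦ,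
      fun _ _ => hE.map_abs hΦ, fun _ => hE.lintegral_re hΦ, hE.integral_dist hΦ,
      fun hbij => ⟨hE.injective hΦ, hE.surjective hΦ hbij.2⟩⟩

end
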